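/- arXiv:1108.4132 — 2 statements merged into one kernel-verified Lean document; each statement's English description precedes it below -/
import Mathlib

section
/- Let q be a prime power, d a nonnegative integer and k a positive integer. Define P(q,d,k) as the sum over all f ∈ F_q[x] with deg(f) = d of the number of k-cycles of f acting on F_q, divided by the number of polynomials in F_q[x] of degree exactly d. If 1 ≤ k ≤ d, or if d = 0 and k = 1, then P(q,d,k) = q(q−1)⋯(q−(k−1)) / (k·q^k). -/
open Polynomial

/-- `c` is a cycle of the map `φ`: a nonempty finite set, closed under `φ`, on which `φ` acts
transitively (equivalently, an orbit of periodic points `α₁ → α₂ → ⋯ → α_k → α₁`). -/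
def IsCycleSet {S : Type*} (φ : S → S) (c : Finset S) : Prop :=
  c.Nonempty ∧ (∀ x ∈ c, φ x ∈ c) ∧ ∀ x ∈ c, ∀ y ∈ c, ∃ j : ℕ, φ^[j] x = y

/-- An injective tuple is cyclic for `φ` if `φ` sends each entry to the next one, the last entry
being sent to the first. -/
def IsCyclicTuple {S : Type*} {m : ℕ} (φ : S → S) (a : Fin (m + 1) → S) : Prop :=
  Function.Injective a ∧ ∀ i, φ (a i) = a (i + 1)

section Cycles

variable {S : Type*} {φ : S → S} {m : ℕ}

open Fin.CommRing in
lemma IsCyclicTuple.iterate_apply {a : Fin (m + 1) → S} (ha : IsCyclicTuple φ a)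
    (i : Fin (m + 1)) (n : ℕ) : φ^[n] (a i) = a (i + (n : Fin (m + 1))) := by
  induction n with
  | zero => simp
  | succ n ih => rw [Function.iterate_succ_apply', ih, ha.2, Nat.cast_succ, add_assoc]

lemma IsCyclicTuple.eq_iterate {a : Fin (m + 1) → S} (ha : IsCyclicTuple φ a)
    (i : Fin (m + 1)) : a i = φ^[i.val] (a 0) := by
  rw [ha.iterate_apply, zero_add, Fin.cast_val_eq_self]

lemma IsCyclicTuple.isCycleSet [DecidableEq S] {a : Fin (m + 1) → S} (ha : IsCyclicTuple φ a) :
    IsCycleSet φ (Finset.univ.image a) := by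
  refine ⟨Finset.univ_nonempty.image a, ?_, ?_⟩
  · simp only [Finset.mem_image, Finset.mem_univ, true_and]
    rintro _ ⟨i, rfl⟩
    exact ⟨i + 1, (ha.2 i).symm⟩
  · simp only [Finset.mem_image, Finset.mem_univ, true_and]
    rintro _ ⟨i, rfl⟩ _ ⟨j, rfl⟩
    refine ⟨(j - i).val, ?_⟩
    rw [ha.iterate_apply, Fin.cast_val_eq_self, add_sub_cancel]

lemma IsCycleSet.mem_periodicPts {c : Finset S} (hc : IsCycleSet φ c) {x : S} (hx : x ∈ c) :
    x ∈ Function.periodicPts φ := by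
  obtain ⟨j, hj⟩ := hc.2.2 (φ x) (hc.2.1 x hx) x hx
  exact Function.mk_mem_periodicPts j.succ_pos hj

lemma IsCycleSet.iterate_mem {c : Finset S} (hc : IsCycleSet φ c) {x : S} (hx : x ∈ c) (n : ℕ) :
    φ^[n] x ∈ c := by
  induction n with
  | zero => exact hx
  | succ n ih => rw [Function.iterate_succ_apply']; exact hc.2.1 _ ih

lemma IsCycleSet.eq_image_range [DecidableEq S] {c : Finset S} (hc : IsCycleSet φ c) {x : S}
    (hx : x ∈ c) : c = (Finset.range (Function.minimalPeriod φ x)).image (fun n => φ^[n] x) := by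
  ext y
  simp only [Finset.mem_image, Finset.mem_range]
  constructor
  · intro hy
    obtain ⟨j, rfl⟩ := hc.2.2 x hx y hy
    exact ⟨_, Nat.mod_lt _ (Function.minimalPeriod_pos_of_mem_periodicPts (hc.mem_periodicPts hx)),
      Function.iterate_mod_minimalPeriod_eq⟩
  · rintro ⟨n, -, rfl⟩
    exact hc.iterate_mem hx n

lemma IsCycleSet.card_eq_minimalPeriod {c : Finset S} (hc : IsCycleSet φ c) {x : S}
    (hx : x ∈ c) : c.card = Function.minimalPeriod φ x := by
  classical
  conv_lhs => rw [hc.eq_image_range hx]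
  rw [Finset.card_image_of_injOn, Finset.card_range]
  simpa using! Function.iterate_injOn_Iio_minimalPeriod (f := φ) (x := x)

lemma isCyclicTuple_iterate {x : S} (h : Function.minimalPeriod φ x = m + 1) :
    IsCyclicTuple φ (fun i : Fin (m + 1) => φ^[i.val] x) := by
  constructor
  · intro i j hij
    exact Fin.ext (Function.iterate_injOn_Iio_minimalPeriod (f := φ) (x := x)
      (by simp only [Set.mem_Iio]; omega) (by simp only [Set.mem_Iio]; omega) hij)
  · intro i
    have hv : (i + 1).val = (i.val + 1) % Function.minimalPeriod φ x := by
      rw [h, Fin.val_add, Fin.val_one', Nat.add_mod_mod]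
    simp only [hv, Function.iterate_mod_minimalPeriod_eq, Function.iterate_succ_apply']

/-- Every cycle of length `m + 1` underlies exactly `m + 1` cyclic tuples. -/
lemma card_isCyclicTuple [Finite S] (φ : S → S) (m : ℕ) :
    Nat.card {a : Fin (m + 1) → S // IsCyclicTuple φ a} =
      Nat.card {c : Finset S // IsCycleSet φ c ∧ c.card = m + 1} * (m + 1) := by
  classical
  have := Fintype.ofFinite S
  let F : {a : Fin (m + 1) → S // IsCyclicTuple φ a} →
      Σ c : {c : Finset S // IsCycleSet φ c ∧ c.card = m + 1}, c.1 := fun a =>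
    ⟨⟨Finset.univ.image a.1, a.2.isCycleSet, by
      rw [Finset.card_image_of_injective _ a.2.1, Finset.card_univ, Fintype.card_fin]⟩,
      ⟨a.1 0, Finset.mem_image_of_mem _ (Finset.mem_univ 0)⟩⟩
  have hF : Function.Bijective F := by
    constructor
    · intro a b hab
      have h0 : a.1 0 = b.1 0 := congrArg (fun t => (t.2 : S)) hab
      ext i
      rw [a.2.eq_iterate, b.2.eq_iterate, h0]
    · rintro ⟨⟨c, hc, hk⟩, ⟨x, hx⟩⟩
      have hp : Function.minimalPeriod φ x = m + 1 := by rw [← hc.card_eq_minimalPeriod hx, hk]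
      refine ⟨⟨_, isCyclicTuple_iterate hp⟩, ?_⟩
      have himg : Finset.univ.image (fun i : Fin (m + 1) => φ^[i.val] x) = c := by
        rw [hc.eq_image_range hx, hp]
        ext y
        simp [Fin.exists_iff]
      subst himg
      rfl
  rw [Nat.card_congr (Equiv.ofBijective F hF), Nat.card_sigma]
  simp only [Nat.card_eq_fintype_card, Fintype.card_coe]
  rw [Finset.sum_congr rfl fun c _ => c.2.2, Finset.sum_const, Finset.card_univ, smul_eq_mul]

end Cycles

section Interpolation

variable {F : Type*} [Field F]

instance finite_degree_eq [Finite F] (d : ℕ) :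
    Finite {f : F[X] // f.degree = (d : WithBot ℕ)} := by
  have : Finite (degreeLT F (d + 1)) := Finite.of_equiv _ (degreeLTEquiv F (d + 1)).toEquiv.symm
  refine Finite.of_injective (β := degreeLT F (d + 1)) (fun f => ⟨f.1, ?_⟩) ?_
  · rw [mem_degreeLT, f.2]
    exact_mod_cast d.lt_succ_self
  · intro f g h
    exact Subtype.ext (Subtype.mk.inj h)

instance nonempty_degree_eq (d : ℕ) : Nonempty {f : F[X] // f.degree = (d : WithBot ℕ)} :=
  ⟨⟨X ^ d, degree_X_pow d⟩⟩

/-- The polynomials of degree `d` with prescribed values at `k ≤ d` distinct nodes are as many as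
the polynomials of degree `d - k`. -/
lemma card_degree_eq_and_eval_eq {k d : ℕ} (hkd : k ≤ d) {a : Fin k → F}
    (ha : Function.Injective a) (v : Fin k → F) :
    Nat.card {f : F[X] // f.degree = (d : WithBot ℕ) ∧ ∀ i, f.eval (a i) = v i} =
      Nat.card {g : F[X] // g.degree = ((d - k : ℕ) : WithBot ℕ)} := by
  classical
  set L := Lagrange.interpolate Finset.univ a v
  set M := Lagrange.nodal Finset.univ a with hM
  have hLd : L.degree < (k : WithBot ℕ) := by
    have := Lagrange.degree_interpolate_lt (s := Finset.univ) v ha.injOn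
    rwa [Finset.card_univ, Fintype.card_fin] at this
  have hLe (i) : L.eval (a i) = v i :=
    Lagrange.eval_interpolate_at_node v ha.injOn (Finset.mem_univ i)
  have hMd : M.degree = (k : WithBot ℕ) := by
    rw [hM, Lagrange.degree_nodal, Finset.card_univ, Fintype.card_fin]
  have hMe (i) : M.eval (a i) = 0 := Lagrange.eval_nodal_at_node (Finset.mem_univ i)
  have hM0 : M ≠ 0 := Lagrange.nodal_ne_zero
  have hLd' : L.degree < (d : WithBot ℕ) := hLd.trans_le (by exact_mod_cast hkd)
  symm
  refine Nat.card_congr (Equiv.ofBijective (fun g => ⟨M * g.1 + L, ?_, ?_⟩) ⟨?_, ?_⟩)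
  · have hd : (M * g.1).degree = (d : WithBot ℕ) := by
      rw [degree_mul, hMd, g.2, ← Nat.cast_add, Nat.add_sub_cancel' hkd]
    rw [degree_add_eq_left_of_degree_lt (by rwa [hd]), hd]
  · intro i
    rw [eval_add, eval_mul, hMe, hLe, zero_mul, zero_add]
  · intro g g' h
    exact Subtype.ext (mul_left_cancel₀ hM0 (add_right_cancel (congrArg Subtype.val h)))
  · rintro ⟨f, hfd, hfe⟩
    have hdvd : M ∣ f - L := by
      rw [hM, Lagrange.nodal_eq]
      refine Finset.prod_dvd_of_coprime
        (fun i _ j _ hij => pairwise_coprime_X_sub_C ha hij) fun i _ => ?_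
      rw [dvd_iff_isRoot, IsRoot.def, eval_sub, hfe, hLe, sub_self]
    obtain ⟨g, hg⟩ := hdvd
    have hfLd : (M * g).degree = (d : WithBot ℕ) := by
      rw [← hg, degree_sub_eq_left_of_degree_lt (by rwa [hfd]), hfd]
    have hg0 : g ≠ 0 := by
      rintro rfl
      simp at hfLd
    refine ⟨⟨g, ?_⟩, Subtype.ext ?_⟩
    · rw [degree_mul, hMd, degree_eq_natDegree hg0, ← Nat.cast_add] at hfLd
      rw [degree_eq_natDegree hg0]
      have : k + g.natDegree = d := by exact_mod_cast hfLd
      congr 1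
      omega
    · change M * g + L = f
      rw [← hg, sub_add_cancel]

lemma card_degree_eq [Fintype F] {k d : ℕ} (hkd : k ≤ d) (hk : k ≤ Fintype.card F) :
    Nat.card {f : F[X] // f.degree = (d : WithBot ℕ)} =
      Fintype.card F ^ k * Nat.card {g : F[X] // g.degree = ((d - k : ℕ) : WithBot ℕ)} := by
  classical
  obtain ⟨a⟩ : Nonempty (Fin k ↪ F) :=
    Function.Embedding.nonempty_of_card_le (by rwa [Fintype.card_fin])
  let e : {f : F[X] // f.degree = (d : WithBot ℕ)} ≃ Σ v : Fin k → F,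
      {f : F[X] // f.degree = (d : WithBot ℕ) ∧ ∀ i, f.eval (a i) = v i} :=
    { toFun := fun f => ⟨fun i => f.1.eval (a i), f.1, f.2, fun _ => rfl⟩
      invFun := fun t => ⟨t.2.1, t.2.2.1⟩
      left_inv := fun _ => rfl
      right_inv := by
        rintro ⟨v, f, hd, hv⟩
        obtain rfl : (fun i => f.eval (a i)) = v := funext hv
        rfl }
  have (v : Fin k → F) :
      Finite {f : F[X] // f.degree = (d : WithBot ℕ) ∧ ∀ i, f.eval (a i) = v i} :=
    Finite.of_injective (β := {f : F[X] // f.degree = (d : WithBot ℕ)})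
      (fun f => ⟨f.1, f.2.1⟩) fun f g h => Subtype.ext (Subtype.mk.inj h)
  rw [Nat.card_congr e, Nat.card_sigma]
  simp only [card_degree_eq_and_eval_eq hkd a.injective]
  simp

/-- Pairs of a polynomial of degree `d` and a cyclic tuple of length `m + 1 ≤ d`. -/
lemma card_degree_eq_and_isCyclicTuple [Fintype F] {m d : ℕ} (hmd : m + 1 ≤ d) :
    Nat.card (Σ f : {f : F[X] // f.degree = (d : WithBot ℕ)},
        {a : Fin (m + 1) → F // IsCyclicTuple (fun x => f.1.eval x) a}) =
      (Fintype.card F).descFactorial (m + 1) *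
        Nat.card {g : F[X] // g.degree = ((d - (m + 1) : ℕ) : WithBot ℕ)} := by
  classical
  let e : (Σ f : {f : F[X] // f.degree = (d : WithBot ℕ)},
        {a : Fin (m + 1) → F // IsCyclicTuple (fun x => f.1.eval x) a}) ≃
      Σ a : Fin (m + 1) ↪ F,
        {f : F[X] // f.degree = (d : WithBot ℕ) ∧ ∀ i, f.eval (a i) = a (i + 1)} :=
    { toFun := fun t => ⟨⟨t.2.1, t.2.2.1⟩, t.1.1, t.1.2, t.2.2.2⟩
      invFun := fun t => ⟨⟨t.2.1, t.2.2.1⟩, t.1, t.1.injective, t.2.2.2⟩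
      left_inv := fun _ => rfl
      right_inv := fun _ => rfl }
  have (a : Fin (m + 1) ↪ F) :
      Finite {f : F[X] // f.degree = (d : WithBot ℕ) ∧ ∀ i, f.eval (a i) = a (i + 1)} :=
    Finite.of_injective (β := {f : F[X] // f.degree = (d : WithBot ℕ)})
      (fun f => ⟨f.1, f.2.1⟩) fun f g h => Subtype.ext (Subtype.mk.inj h)
  rw [Nat.card_congr e, Nat.card_sigma,
    Finset.sum_congr rfl fun a _ =>
      card_degree_eq_and_eval_eq hmd a.injective fun i => a (i + 1),
    Finset.sum_const, Finset.card_univ, Fintype.card_embedding_eq, Fintype.card_fin, smul_eq_mul]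

lemma card_degree_eq_and_isCycleSet [Fintype F] {m d : ℕ} (hmd : m + 1 ≤ d) :
    Nat.card {p : F[X] × Finset F // p.1.degree = (d : WithBot ℕ) ∧
        IsCycleSet (fun x => p.1.eval x) p.2 ∧ p.2.card = m + 1} * (m + 1) =
      (Fintype.card F).descFactorial (m + 1) *
        Nat.card {g : F[X] // g.degree = ((d - (m + 1) : ℕ) : WithBot ℕ)} := by
  classical
  have := Fintype.ofFinite {f : F[X] // f.degree = (d : WithBot ℕ)}
  let e : {p : F[X] × Finset F // p.1.degree = (d : WithBot ℕ) ∧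
        IsCycleSet (fun x => p.1.eval x) p.2 ∧ p.2.card = m + 1} ≃
      Σ f : {f : F[X] // f.degree = (d : WithBot ℕ)},
        {c : Finset F // IsCycleSet (fun x => f.1.eval x) c ∧ c.card = m + 1} :=
    { toFun := fun p => ⟨⟨p.1.1, p.2.1⟩, p.1.2, p.2.2⟩
      invFun := fun t => ⟨(t.1.1, t.2.1), t.1.2, t.2.2⟩
      left_inv := fun _ => rfl
      right_inv := fun _ => rfl }
  rw [← card_degree_eq_and_isCyclicTuple hmd, Nat.card_congr e, Nat.card_sigma, Nat.card_sigma,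
    Finset.sum_mul]
  exact Finset.sum_congr rfl fun f _ => (card_isCyclicTuple _ m).symm

/-- A nonzero constant has exactly one fixed point. -/
lemma card_degree_zero_and_isCycleSet :
    Nat.card {p : F[X] × Finset F // p.1.degree = ((0 : ℕ) : WithBot ℕ) ∧
        IsCycleSet (fun x => p.1.eval x) p.2 ∧ p.2.card = 1} =
      Nat.card {f : F[X] // f.degree = ((0 : ℕ) : WithBot ℕ)} := by
  refine Nat.card_congr (Equiv.ofBijective (fun p => ⟨p.1.1, p.2.1⟩) ⟨?_, ?_⟩)
  · rintro ⟨⟨f, c⟩, hf, hc, hc1⟩ ⟨⟨g, c'⟩, hg, hc', hc1'⟩ h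
    obtain rfl : f = g := congrArg Subtype.val h
    obtain ⟨x, rfl⟩ := Finset.card_eq_one.mp hc1
    obtain ⟨y, rfl⟩ := Finset.card_eq_one.mp hc1'
    have hx : f.eval x = x := by simpa using hc.2.1 x (by simp)
    have hy : f.eval y = y := by simpa using hc'.2.1 y (by simp)
    have hxy : f.eval x = f.eval y := by
      rw [eq_C_of_degree_eq_zero (p := f) hf, eval_C, eval_C]
    obtain rfl : x = y := by rw [← hx, hxy, hy]
    rfl
  · rintro ⟨f, hf⟩
    refine ⟨⟨(f, {f.coeff 0}), hf, ⟨by simp, ?_, ?_⟩, by simp⟩, rfl⟩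
    · intro x _
      simp only [Finset.mem_singleton]
      conv_lhs => rw [eq_C_of_degree_eq_zero hf, eval_C]
    · intro x hx y hy
      simp only [Finset.mem_singleton] at hx hy
      exact ⟨0, by rw [hx, hy]; rfl⟩

end Interpolation

/-- **Corollary 2.2.** If `1 ≤ k ≤ d`, or if `d = 0` and `k = 1`, then the average number of
`k`-cycles of a degree-`d` polynomial over `F_q` is `q(q-1)⋯(q-(k-1)) / (k⬝q^k)`. -/
theorem avg_k_cycles_of_polynomials_of_degree_eq
    (q d k : ℕ) (F : Type) [Field F] [Fintype F] (hF : Fintype.card F = q)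
    (h : (1 ≤ k ∧ k ≤ d) ∨ (d = 0 ∧ k = 1)) :
    (Nat.card {p : Polynomial F × Finset F //
        p.1.degree = (d : WithBot ℕ) ∧
          IsCycleSet (fun x => p.1.eval x) p.2 ∧ p.2.card = k} : ℚ) /
      (Nat.card {f : Polynomial F // f.degree = (d : WithBot ℕ)} : ℚ)
      = (∏ j ∈ Finset.range k, ((q : ℚ) - j)) / (k * (q : ℚ) ^ k) := by
  have hN (n : ℕ) : (Nat.card {f : F[X] // f.degree = (n : WithBot ℕ)} : ℚ) ≠ 0 :=
    Nat.cast_ne_zero.mpr Nat.card_pos.ne'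
  have hq : (q : ℚ) ≠ 0 := by
    rw [← hF]
    exact Nat.cast_ne_zero.mpr Fintype.card_ne_zero
  obtain ⟨hk, hkd⟩ | ⟨rfl, rfl⟩ := h
  · obtain ⟨m, rfl⟩ := Nat.exists_eq_add_of_le' hk
    have hcyc := card_degree_eq_and_isCycleSet (F := F) hkd
    rw [hF] at hcyc
    replace hcyc := congrArg (Nat.cast (R := ℚ)) hcyc
    rw [Nat.cast_mul, Nat.cast_mul] at hcyc
    rw [← descPochhammer_eval_eq_prod_range, descPochhammer_eval_eq_descFactorial,
      div_eq_div_iff (hN d) (by positivity)]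
    obtain hmq | hmq := le_or_gt (m + 1) q
    · have hdeg := card_degree_eq (F := F) hkd (hF ▸ hmq)
      rw [hF] at hdeg
      rw [hdeg, ← mul_assoc, hcyc]
      push_cast
      ring
    · rw [Nat.descFactorial_eq_zero_iff_lt.mpr hmq] at hcyc ⊢
      rw [← mul_assoc, hcyc]
      simp
  · rw [card_degree_zero_and_isCycleSet, div_self (hN 0)]
    simp [hq]
end

section
/- Let q be a prime power and d a positive integer. Define R(q,d) as the total number of cycles of f acting on P^1(F_q) (equivalently, connected components of the functional graph of f on P^1(F_q)), summed over all rational functions f on P^1(F_q) of degree exactly d, divided by the number of rational functions of degree exactly d. Then R(q,d) > Σ_{k=1}^{min{d,⌊√q⌋}} (1/k) − 4 > ln(min{d,⌊√q⌋} + 1) − 4. -/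
open Polynomial
open scoped Classical

/-- The self-map of `P¹(F) = F ∪ {∞}` (modeled as `Option F`, with `none` = `∞`) induced by the
rational function `f/g`.  At a finite point `a`: if `g(a) ≠ 0` the value is `f(a)/g(a)`; if
`g(a) = 0` and `f(a) ≠ 0` the value is `∞` (for coprime `(f,g)` the remaining case is junk).
At `∞`: the value is `∞`, the ratio of leading coefficients, or `0`, according to whether
`deg f > deg g`, `deg f = deg g`, or `deg f < deg g`.  In particular a pair `(c, 0)` with
`c ≠ 0` induces the constant map `∞`. -/
noncomputable def ratMap {F : Type*} [Field F] (f g : Polynomial F) : Option F → Option F :=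
  fun x =>
    match x with
    | some a =>
        if g.eval a = 0 then (if f.eval a = 0 then some 0 else none)
        else some (f.eval a / g.eval a)
    | none =>
        if g.degree < f.degree then none
        else if f.degree = g.degree then some (f.leadingCoeff / g.leadingCoeff)
        else some 0

/-- Two pairs of polynomials differ by a nonzero scalar. -/
def ScaleRel {F : Type*} [Field F] (p₁ p₂ : Polynomial F × Polynomial F) : Prop :=
  ∃ c : F, c ≠ 0 ∧ p₂.1 = c • p₁.1 ∧ p₂.2 = c • p₁.2

/-- The rational functions on `P¹(F)` of degree exactly `d`: coprime pairs of polynomials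
`(f, g)` with `max (deg f) (deg g) = d`, up to a common nonzero scalar.  (This includes all
constant maps, of degree `0`, in particular the constant map `∞`, class of `(1, 0)`.) -/
def RatFn (F : Type) [Field F] (d : ℕ) : Type :=
  Quot (fun p₁ p₂ : {p : Polynomial F × Polynomial F //
      IsCoprime p.1 p.2 ∧ max p.1.natDegree p.2.natDegree = d} => ScaleRel p₁.1 p₂.1)

/-- The rational functions on `P¹(F)` of degree at most `d`: coprime pairs of polynomials
`(f, g)` with `max (deg f) (deg g) ≤ d`, up to a common nonzero scalar. -/
def RatFnLe (F : Type) [Field F] (d : ℕ) : Type :=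
  Quot (fun p₁ p₂ : {p : Polynomial F × Polynomial F //
      IsCoprime p.1 p.2 ∧ max p.1.natDegree p.2.natDegree ≤ d} => ScaleRel p₁.1 p₂.1)

section Counting

variable {F : Type} [Field F] [Fintype F]

theorem finite_setOf_degree_lt (n : ℕ) : {f : F[X] | f.degree < n}.Finite := by
  have : Finite (degreeLT F n) := Finite.of_injective _ (degreeLTEquiv F n).injective
  refine (Set.toFinite (degreeLT F n : Set F[X])).subset fun f hf => ?_
  exact mem_degreeLT.2 hf

/-- The finite set of polynomials of degree less than `n` over a finite field. -/
noncomputable def polysLT (F : Type) [Field F] [Fintype F] (n : ℕ) : Finset F[X] :=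
  (finite_setOf_degree_lt (F := F) n).toFinset

theorem mem_polysLT {n : ℕ} {f : F[X]} : f ∈ polysLT F n ↔ f.degree < n := by
  simp [polysLT]

theorem card_polysLT (n : ℕ) : (polysLT F n).card = Fintype.card F ^ n := by
  have h1 : Nat.card (degreeLT F n) = Fintype.card F ^ n := by
    rw [Nat.card_congr (degreeLTEquiv F n).toEquiv]
    simp
  rw [← h1, polysLT, ← Set.ncard_eq_toFinset_card _ (finite_setOf_degree_lt n),
    ← Nat.card_coe_set_eq]
  exact Nat.card_congr (Equiv.subtypeEquivRight fun f => mem_degreeLT.symm)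

/-- Polynomials of degree less than `a` taking the values `w` on `S`. -/
noncomputable def interpLT (a : ℕ) (S : Finset F) (w : F → F) : Finset F[X] :=
  (polysLT F a).filter fun f => ∀ s ∈ S, f.eval s = w s

theorem card_interpLT_le (a : ℕ) (S : Finset F) (w : F → F) :
    (interpLT a S w).card ≤ Fintype.card F ^ (a - S.card) := by
  have hP : (Lagrange.nodal S id : F[X]).Monic := Lagrange.nodal_monic
  have hPd : (Lagrange.nodal S id : F[X]).degree = S.card := Lagrange.degree_nodal
  rw [← card_polysLT]
  refine Finset.card_le_card_of_injOn (fun f => f /ₘ Lagrange.nodal S id) ?_ ?_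
  · intro f hf
    simp only [interpLT, Finset.coe_filter, Set.mem_ofPred_eq, mem_polysLT] at hf
    simp only [Finset.mem_coe, mem_polysLT]
    by_cases h0 : f /ₘ Lagrange.nodal S id = 0
    · rw [h0, degree_zero]; exact WithBot.bot_lt_coe _
    · rw [degree_eq_natDegree h0, natDegree_divByMonic _ hP, Nat.cast_lt]
      have h1 : ¬ f.degree < (Lagrange.nodal S id : F[X]).degree := by
        rwa [← divByMonic_eq_zero_iff hP]
      have hf0 : f ≠ 0 := by rintro rfl; simp at h0
      rw [hPd, degree_eq_natDegree hf0, Nat.cast_lt] at h1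
      have h2 := hf.1
      rw [degree_eq_natDegree hf0, Nat.cast_lt] at h2
      rw [natDegree_eq_of_degree_eq_some hPd]
      omega
  · intro f hf g hg hfg
    simp only [interpLT, Finset.coe_filter, Set.mem_ofPred_eq, mem_polysLT] at hf hg
    have hmod : ∀ p : F[X], ∀ s ∈ S, (p %ₘ Lagrange.nodal S id).eval s = p.eval s := by
      intro p s hs
      conv_rhs => rw [← modByMonic_add_div p (Lagrange.nodal S id)]
      have : (Lagrange.nodal S (id : F → F)).eval s = 0 :=
        Lagrange.eval_nodal_at_node (v := id) hs
      simp [this]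
    have : f %ₘ Lagrange.nodal S id = g %ₘ Lagrange.nodal S id := by
      refine eq_of_degrees_lt_of_eval_finset_eq S ?_ ?_ ?_
      · rw [← hPd]; exact degree_modByMonic_lt _ hP
      · rw [← hPd]; exact degree_modByMonic_lt _ hP
      · intro s hs
        rw [hmod f s hs, hmod g s hs, hf.2 s hs, hg.2 s hs]
    rw [← modByMonic_add_div f (Lagrange.nodal S id),
      ← modByMonic_add_div g (Lagrange.nodal S id), this]
    simp only at hfg
    rw [hfg]

theorem le_card_interpLT {a : ℕ} {S : Finset F} (hS : S.card ≤ a) (w : F → F) :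
    Fintype.card F ^ (a - S.card) ≤ (interpLT a S w).card := by
  have hP0 : (Lagrange.nodal S id : F[X]) ≠ 0 := Lagrange.nodal_ne_zero
  have hPd : (Lagrange.nodal S id : F[X]).degree = S.card := Lagrange.degree_nodal
  rw [← card_polysLT]
  refine Finset.card_le_card_of_injOn
    (fun h => Lagrange.interpolate S id w + Lagrange.nodal S id * h) ?_ ?_
  · intro h hh
    simp only [Finset.mem_coe, mem_polysLT] at hh
    simp only [interpLT, Finset.coe_filter, Set.mem_ofPred_eq, mem_polysLT]
    refine ⟨(degree_add_le _ _).trans_lt (max_lt ?_ ?_), fun s hs => ?_⟩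
    · exact (Lagrange.degree_interpolate_lt w Function.injective_id.injOn).trans_le
        (by exact_mod_cast hS)
    · by_cases h0 : h = 0
      · rw [h0, mul_zero, degree_zero]; exact WithBot.bot_lt_coe _
      · rw [degree_mul, hPd, degree_eq_natDegree h0]
        rw [degree_eq_natDegree h0, Nat.cast_lt] at hh
        norm_cast
        omega
    · have h1 : (Lagrange.nodal S (id : F → F)).eval s = 0 :=
        Lagrange.eval_nodal_at_node (v := id) hs
      have h2 := Lagrange.eval_interpolate_at_node w
        (Function.injective_id.injOn (s := (S : Set F))) hs
      simp only [id] at h2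
      rw [eval_add, eval_mul, h1, zero_mul, add_zero]; exact h2
  · intro h _ h' _ hh
    simpa [hP0] using hh

/-- Pairs `(f, g)` with `deg f < a`, `deg g < b` and `f = v * g` on `S`. -/
noncomputable def pairsLT (a b : ℕ) (S : Finset F) (v : F → F) : Finset (F[X] × F[X]) :=
  (polysLT F a ×ˢ polysLT F b).filter fun p => ∀ s ∈ S, p.1.eval s = v s * p.2.eval s

theorem mem_pairsLT {a b : ℕ} {S : Finset F} {v : F → F} {p : F[X] × F[X]} :
    p ∈ pairsLT a b S v ↔ (p.1.degree < a ∧ p.2.degree < b) ∧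
      ∀ s ∈ S, p.1.eval s = v s * p.2.eval s := by
  simp [pairsLT, mem_polysLT]

theorem card_pairsLT_fiber (a b : ℕ) (S : Finset F) (v : F → F) {g : F[X]}
    (hg : g ∈ polysLT F b) :
    ((pairsLT a b S v).filter fun p => p.2 = g).card =
      (interpLT a S fun s => v s * g.eval s).card := by
  refine Finset.card_bij (fun p _ => p.1) ?_ ?_ ?_
  · rintro ⟨f, g'⟩ hp
    simp only [Finset.mem_filter, mem_pairsLT] at hp
    obtain ⟨hp, rfl⟩ := hp
    simpa [interpLT, mem_polysLT] using ⟨hp.1.1, hp.2⟩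
  · rintro ⟨f, g'⟩ hp ⟨f', g''⟩ hp' h
    simp only [Finset.mem_filter] at hp hp'
    simp_all
  · intro f hf
    rw [mem_polysLT] at hg
    simp only [interpLT, Finset.mem_filter, mem_polysLT] at hf
    exact ⟨(f, g), by simpa [mem_pairsLT] using ⟨⟨hf.1, hg⟩, hf.2⟩, rfl⟩

theorem card_pairsLT_le (a b : ℕ) (S : Finset F) (v : F → F) :
    (pairsLT a b S v).card ≤ Fintype.card F ^ (a - S.card) * Fintype.card F ^ b := by
  rw [← card_polysLT b]
  refine Finset.card_le_mul_card_image_of_maps_to (f := Prod.snd) ?_ _ fun g hg => ?_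
  · intro p hp
    exact mem_polysLT.2 (mem_pairsLT.1 hp).1.2
  · rw [card_pairsLT_fiber a b S v hg]
    exact card_interpLT_le _ _ _

theorem le_card_pairsLT {a : ℕ} (b : ℕ) {S : Finset F} (hS : S.card ≤ a) (v : F → F) :
    Fintype.card F ^ (a - S.card) * Fintype.card F ^ b ≤ (pairsLT a b S v).card := by
  rw [← card_polysLT b]
  refine Finset.mul_card_image_le_card_of_maps_to (f := Prod.snd) ?_ _ fun g hg => ?_
  · intro p hp
    exact mem_polysLT.2 (mem_pairsLT.1 hp).1.2
  · rw [card_pairsLT_fiber a b S v hg]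
    exact le_card_interpLT hS _

/-- Monic polynomials of degree `j`. -/
noncomputable def monicsOfDegree (F : Type) [Field F] [Fintype F] (j : ℕ) : Finset F[X] :=
  (polysLT F (j + 1)).filter fun h => h.Monic ∧ h.natDegree = j

theorem card_monicsOfDegree_le (j : ℕ) :
    (monicsOfDegree F j).card ≤ Fintype.card F ^ j := by
  rw [← card_polysLT]
  refine Finset.card_le_card_of_injOn (fun h => h - X ^ j) ?_ ?_
  · intro h hh
    simp only [monicsOfDegree, Finset.coe_filter, Set.mem_ofPred_eq] at hh
    simp only [Finset.mem_coe, mem_polysLT]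
    have hd : h.degree = j := by rw [degree_eq_natDegree hh.2.1.ne_zero, hh.2.2]
    rw [← hd]
    exact degree_sub_lt_left (by rw [hd, degree_X_pow]) hh.2.1.ne_zero
      (by simp [hh.2.1.leadingCoeff])
  · intro h _ h' _ hh
    simpa using hh

theorem sum_range_pow_sub_le {q : ℕ} (hq : 2 ≤ q) (e d : ℕ) :
    ∑ j ∈ Finset.range d, q ^ (e - j) ≤ 2 * q ^ e + (d - e) := by
  induction e generalizing d with
  | zero => simp
  | succ e ih =>
    cases d with
    | zero => simp
    | succ d =>
      rw [Finset.sum_range_succ']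
      have h := ih d
      have h2 : 2 * q ^ e ≤ q ^ (e + 1) := by
        rw [pow_succ, mul_comm]; exact Nat.mul_le_mul_left _ hq
      simp only [Nat.add_sub_add_right, Nat.sub_zero]
      omega

end Counting

theorem degree_lt_of_mul_degree_lt {F : Type} [Field F] {h f : F[X]} {n j : ℕ} (hh : h.degree = j)
    (hf : (h * f).degree < n) : f.degree < (n - j : ℕ) := by
  by_cases h0 : f = 0
  · rw [h0, degree_zero]; exact WithBot.bot_lt_coe _
  · rw [degree_mul, hh, degree_eq_natDegree h0] at hf
    rw [degree_eq_natDegree h0]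
    norm_cast at hf ⊢
    omega

section Coprime

variable {F : Type} [Field F] [Fintype F]

/-- Coprime pairs `(f, g)` with `deg f = d`, `deg g ≤ d` and `f = v * g` on `S`. -/
noncomputable def coprimePairs (d : ℕ) (S : Finset F) (v : F → F) : Finset (F[X] × F[X]) :=
  (pairsLT (d + 1) (d + 1) S v).filter fun p => IsCoprime p.1 p.2 ∧ p.1.natDegree = d

/-- Pairs of `pairsLT` with a common root in `S`. -/
noncomputable def commonRootPairs (d : ℕ) (S : Finset F) (v : F → F) : Finset (F[X] × F[X]) :=
  S.biUnion fun s => (pairsLT d d (S.erase s) v).image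
    fun p => ((X - C s) * p.1, (X - C s) * p.2)

/-- Pairs of `pairsLT` with a common monic divisor of positive degree without roots in `S`. -/
noncomputable def commonDivisorPairs (d : ℕ) (S : Finset F) (v : F → F) :
    Finset (F[X] × F[X]) :=
  (Finset.range d).biUnion fun j => (monicsOfDegree F (j + 1)).biUnion fun h =>
    (pairsLT (d - j) (d - j) S v).image fun p => (h * p.1, h * p.2)

theorem card_commonRootPairs_le {d : ℕ} {S : Finset F} (hS : S.card ≤ d) (v : F → F) :
    (commonRootPairs d S v).card ≤
      S.card * (Fintype.card F ^ (d - S.card) * Fintype.card F ^ (d + 1)) := by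
  refine Finset.card_biUnion_le.trans ?_
  rw [← smul_eq_mul]
  refine Finset.sum_le_card_nsmul _ _ _ fun s hs => ?_
  refine Finset.card_image_le.trans ((card_pairsLT_le _ _ _ _).trans (le_of_eq ?_))
  rw [Finset.card_erase_of_mem hs, ← pow_add, ← pow_add]
  have := Finset.card_pos.2 ⟨s, hs⟩
  congr 1
  omega

theorem card_commonDivisorPairs_le {d : ℕ} {S : Finset F} (hS : S.card ≤ d) (v : F → F) :
    (commonDivisorPairs d S v).card ≤
      (S.card + 2) * (Fintype.card F ^ (d - S.card) * Fintype.card F ^ (d + 1)) := by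
  have hq : 2 ≤ Fintype.card F := Fintype.one_lt_card
  set q := Fintype.card F
  calc (commonDivisorPairs d S v).card
      ≤ ∑ j ∈ Finset.range d, q ^ (j + 1) * (q ^ (d - j - S.card) * q ^ (d - j)) := by
        refine Finset.card_biUnion_le.trans (Finset.sum_le_sum fun j _ => ?_)
        refine Finset.card_biUnion_le.trans ?_
        refine (Finset.sum_le_card_nsmul _ _ (q ^ (d - j - S.card) * q ^ (d - j))
          fun h _ => Finset.card_image_le.trans (card_pairsLT_le _ _ _ _)).trans ?_
        rw [smul_eq_mul]
        exact Nat.mul_le_mul_right _ (card_monicsOfDegree_le _)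
    _ = (∑ j ∈ Finset.range d, q ^ (d - S.card - j)) * q ^ (d + 1) := by
        rw [Finset.sum_mul]
        refine Finset.sum_congr rfl fun j hj => ?_
        rw [Finset.mem_range] at hj
        rw [← pow_add, ← pow_add, ← pow_add]
        congr 1
        omega
    _ ≤ (2 * q ^ (d - S.card) + S.card * q ^ (d - S.card)) * q ^ (d + 1) := by
        refine Nat.mul_le_mul_right _ ((sum_range_pow_sub_le hq _ _).trans ?_)
        refine Nat.add_le_add_left ?_ _
        rw [Nat.sub_sub_self hS]
        exact Nat.le_mul_of_pos_right _ (by positivity)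
    _ = _ := by ring

theorem pairsLT_subset (d : ℕ) (S : Finset F) (v : F → F) :
    pairsLT (d + 1) (d + 1) S v ⊆ coprimePairs d S v ∪
      (pairsLT d (d + 1) S v ∪ (commonRootPairs d S v ∪ commonDivisorPairs d S v)) := by
  rintro ⟨f, g⟩ hp
  simp only [Finset.mem_union]
  have hp' := mem_pairsLT.1 hp
  simp only at hp'
  obtain ⟨⟨hf, hg⟩, hv⟩ := hp'
  by_cases hfd : f.degree < d
  · exact Or.inr (Or.inl (mem_pairsLT.2 ⟨⟨hfd, hg⟩, hv⟩))
  have hf0 : f ≠ 0 := by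
    rintro rfl
    exact hfd (by rw [degree_zero]; exact WithBot.bot_lt_coe _)
  have hfn : f.natDegree = d := by
    rw [degree_eq_natDegree hf0, Nat.cast_lt] at hf hfd
    omega
  by_cases hco : IsCoprime f g
  · exact Or.inl (Finset.mem_filter.2 ⟨hp, hco, hfn⟩)
  refine Or.inr (Or.inr ?_)
  by_cases hroot : ∃ s ∈ S, f.eval s = 0 ∧ g.eval s = 0
  · left
    obtain ⟨s, hs, hfs, hgs⟩ := hroot
    obtain ⟨f', rfl⟩ := dvd_iff_isRoot.2 hfs
    obtain ⟨g', rfl⟩ := dvd_iff_isRoot.2 hgs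
    refine Finset.mem_biUnion.2 ⟨s, hs, Finset.mem_image.2 ⟨(f', g'), ?_, rfl⟩⟩
    refine mem_pairsLT.2 ⟨⟨?_, ?_⟩, fun t ht => ?_⟩
    · exact degree_lt_of_mul_degree_lt (j := 1) (by simp) hf
    · exact degree_lt_of_mul_degree_lt (j := 1) (by simp) hg
    · have h1 := hv t (Finset.mem_of_mem_erase ht)
      have h2 : t - s ≠ 0 := sub_ne_zero.2 (Finset.ne_of_mem_erase ht)
      simp only [eval_mul, eval_sub, eval_X, eval_C] at h1
      refine mul_left_cancel₀ h2 ?_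
      rw [h1]; ring
  · right
    set h := normalize (EuclideanDomain.gcd f g) with hdef
    have hgcd0 : EuclideanDomain.gcd f g ≠ 0 := fun h0 =>
      hf0 (EuclideanDomain.gcd_eq_zero_iff.1 h0).1
    have hm : h.Monic := monic_normalize hgcd0
    have hdvdf : h ∣ f := normalize_dvd_iff.2 (EuclideanDomain.gcd_dvd_left f g)
    have hdvdg : h ∣ g := normalize_dvd_iff.2 (EuclideanDomain.gcd_dvd_right f g)
    have hnu : ¬ IsUnit h := by
      rwa [hdef, (normalize_associated _).isUnit_iff, EuclideanDomain.gcd_isUnit_iff]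
    have hpos : 0 < h.natDegree := by
      rw [Nat.pos_iff_ne_zero]
      intro h0
      exact hnu (by rw [hm.natDegree_eq_zero.1 h0]; exact isUnit_one)
    have hle : h.natDegree ≤ d := hfn ▸ natDegree_le_of_dvd hdvdf hf0
    obtain ⟨f', hf'⟩ := hdvdf
    obtain ⟨g', hg'⟩ := hdvdg
    have hhd : h.degree = h.natDegree := degree_eq_natDegree hm.ne_zero
    have hsub : d + 1 - h.natDegree = d - (h.natDegree - 1) := by omega
    refine Finset.mem_biUnion.2 ⟨h.natDegree - 1, Finset.mem_range.2 (by omega),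
      Finset.mem_biUnion.2 ⟨h, ?_, Finset.mem_image.2 ⟨(f', g'), ?_, by rw [hf', hg']⟩⟩⟩
    · rw [Nat.sub_add_cancel hpos]
      refine Finset.mem_filter.2 ⟨mem_polysLT.2 ?_, hm, rfl⟩
      rw [hhd, Nat.cast_lt]
      omega
    · refine mem_pairsLT.2 ⟨⟨?_, ?_⟩, fun t ht => ?_⟩
      · rw [← hsub]; exact degree_lt_of_mul_degree_lt hhd (hf' ▸ hf)
      · rw [← hsub]; exact degree_lt_of_mul_degree_lt hhd (hg' ▸ hg)
      · have h1 := hv t ht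
        have h2 : h.eval t ≠ 0 := fun h0 =>
          hroot ⟨t, ht, by rw [hf', eval_mul, h0, zero_mul], by rw [hg', eval_mul, h0, zero_mul]⟩
        rw [hf', hg', eval_mul, eval_mul] at h1
        refine mul_left_cancel₀ h2 ?_
        rw [h1]; ring

theorem le_card_coprimePairs {d : ℕ} {S : Finset F} (hS : S.card ≤ d) (v : F → F) :
    Fintype.card F ^ (2 * d + 2 - S.card) ≤ (coprimePairs d S v).card +
      (2 * S.card + 3) * Fintype.card F ^ (2 * d + 1 - S.card) := by
  have h1 := Finset.card_le_card (pairsLT_subset d S v)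
  have h2 := le_card_pairsLT (a := d + 1) (d + 1) (hS.trans d.le_succ) v
  have h3 := card_commonRootPairs_le hS v
  have h4 := card_commonDivisorPairs_le hS v
  have h5 := card_pairsLT_le d (d + 1) S v
  rw [← pow_add] at h2 h3 h4 h5
  rw [show d + 1 - S.card + (d + 1) = 2 * d + 2 - S.card by omega] at h2
  rw [show d - S.card + (d + 1) = 2 * d + 1 - S.card by omega] at h3 h4 h5
  have h6 := Finset.card_union_le (coprimePairs d S v)
    (pairsLT d (d + 1) S v ∪ (commonRootPairs d S v ∪ commonDivisorPairs d S v))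
  have h7 := Finset.card_union_le (pairsLT d (d + 1) S v)
    (commonRootPairs d S v ∪ commonDivisorPairs d S v)
  have h8 := Finset.card_union_le (commonRootPairs d S v) (commonDivisorPairs d S v)
  nlinarith

end Coprime

/-- Coprime pairs of polynomials `(f, g)` with `max (deg f) (deg g) = d`. -/
abbrev RatPair (F : Type) [Field F] (d : ℕ) : Type :=
  {p : F[X] × F[X] // IsCoprime p.1 p.2 ∧ max p.1.natDegree p.2.natDegree = d}

section Scaling

variable {F : Type} [Field F] {d : ℕ}

theorem scaleRel_equivalence :
    Equivalence fun p₁ p₂ : RatPair F d => ScaleRel p₁.1 p₂.1 where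
  refl p := ⟨1, one_ne_zero, by simp, by simp⟩
  symm := by
    rintro p₁ p₂ ⟨c, hc, h1, h2⟩
    exact ⟨c⁻¹, inv_ne_zero hc, by rw [h1, inv_smul_smul₀ hc], by rw [h2, inv_smul_smul₀ hc]⟩
  trans := by
    rintro p₁ p₂ p₃ ⟨c, hc, h1, h2⟩ ⟨c', hc', h1', h2'⟩
    exact ⟨c' * c, mul_ne_zero hc' hc, by rw [h1', h1, smul_smul], by rw [h2', h2, smul_smul]⟩

/-- The rational function represented by a pair. -/
def RatPair.toRatFn (p : RatPair F d) : RatFn F d := Quot.mk _ p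

theorem RatPair.toRatFn_eq_iff {p p' : RatPair F d} :
    p.toRatFn = p'.toRatFn ↔ ScaleRel p.1 p'.1 := by
  refine ⟨fun h => ?_, fun h => Quot.sound h⟩
  exact scaleRel_equivalence.eqvGen_iff.1 (Quot.eqvGen_exact h)

theorem RatPair.toRatFn_surjective : Function.Surjective (RatPair.toRatFn (F := F) (d := d)) :=
  Quot.mk_surjective

theorem RatPair.exists_unit_smul {p p' : RatPair F d} (h : p.toRatFn = p'.toRatFn) :
    ∃ u : Fˣ, p'.1 = u • p.1 := by
  obtain ⟨c, hc, h1, h2⟩ := RatPair.toRatFn_eq_iff.1 h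
  exact ⟨Units.mk0 c hc, Prod.ext h1 h2⟩

/-- Multiplication of a pair by a nonzero scalar. -/
noncomputable def RatPair.scale (u : Fˣ) (p : RatPair F d) : RatPair F d :=
  ⟨u • p.1, by
    have hu : IsUnit (C (u : F)) := isUnit_C.2 u.isUnit
    have h : ∀ f : F[X], u • f = C (u : F) * f := fun f => (C_mul' (u : F) f).symm
    refine ⟨?_, ?_⟩
    · rw [Prod.smul_fst, Prod.smul_snd, h, h]
      exact (isCoprime_mul_unit_left hu _ _).2 p.2.1
    · rw [Prod.smul_fst, Prod.smul_snd, h, h, natDegree_C_mul u.ne_zero,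
        natDegree_C_mul u.ne_zero]
      exact p.2.2⟩

theorem RatPair.toRatFn_scale (u : Fˣ) (p : RatPair F d) :
    (p.scale u).toRatFn = p.toRatFn :=
  (RatPair.toRatFn_eq_iff.2 ⟨(u : F), u.ne_zero, rfl, rfl⟩).symm

theorem RatPair.ne_zero (p : RatPair F d) : p.1 ≠ 0 := by
  intro h
  have h1 := p.2.1
  rw [h] at h1
  exact not_isUnit_zero (isCoprime_zero_left.1 h1)

theorem RatPair.scale_left_injective (p : RatPair F d) :
    Function.Injective fun u : Fˣ => p.scale u := by
  intro u u' h
  have h1 : (u : F) • p.1 = (u' : F) • p.1 := congrArg Subtype.val h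
  exact Units.ext (smul_left_injective F p.ne_zero h1)

variable [Fintype F]

theorem RatPair.mem_polysLT (p : RatPair F d) :
    p.1.1 ∈ polysLT F (d + 1) ∧ p.1.2 ∈ polysLT F (d + 1) := by
  have h := p.2.2
  have hlt : ∀ f : F[X], f.natDegree ≤ d → f ∈ polysLT F (d + 1) := fun f hf =>
    _root_.mem_polysLT.2 (degree_le_natDegree.trans_lt (by exact_mod_cast Nat.lt_succ_of_le hf))
  exact ⟨hlt _ ((le_max_left _ _).trans h.le), hlt _ ((le_max_right _ _).trans h.le)⟩

/-- The coordinates of a pair, as polynomials of degree at most `d`. -/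
noncomputable def RatPair.toPolysLT (p : RatPair F d) :
    polysLT F (d + 1) × polysLT F (d + 1) :=
  (⟨p.1.1, p.mem_polysLT.1⟩, ⟨p.1.2, p.mem_polysLT.2⟩)

theorem RatPair.toPolysLT_injective :
    Function.Injective (RatPair.toPolysLT (F := F) (d := d)) := by
  intro p p' h
  simp only [RatPair.toPolysLT, Prod.mk.injEq, Subtype.mk.injEq] at h
  exact Subtype.ext (Prod.ext h.1 h.2)

noncomputable instance : Fintype (RatPair F d) :=
  Fintype.ofInjective _ RatPair.toPolysLT_injective

instance : Finite (RatFn F d) := Finite.of_surjective _ RatPair.toRatFn_surjective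

theorem card_ratPair_le : Fintype.card (RatPair F d) ≤ Fintype.card F ^ (2 * d + 2) := by
  refine (Fintype.card_le_of_injective _ RatPair.toPolysLT_injective).trans (le_of_eq ?_)
  rw [Fintype.card_prod, Fintype.card_coe, card_polysLT, ← pow_add]
  congr 1
  omega

theorem card_units_mul_card_ratFn_le :
    Nat.card Fˣ * Nat.card (RatFn F d) ≤ Fintype.card (RatPair F d) := by
  rw [← Nat.card_prod, ← Nat.card_eq_fintype_card]
  obtain ⟨r, hr⟩ := (RatPair.toRatFn_surjective (F := F) (d := d)).hasRightInverse
  refine Nat.card_le_card_of_injective (fun x : Fˣ × RatFn F d => (r x.2).scale x.1) ?_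
  rintro ⟨u, x⟩ ⟨u', x'⟩ h
  have hx : x = x' := by
    have := congrArg RatPair.toRatFn h
    simpa only [RatPair.toRatFn_scale, hr x, hr x'] using this
  subst hx
  exact Prod.ext ((r x).scale_left_injective h) rfl

/-- The pairs `(p, c)` with `c` a cycle of the map induced by `p`. -/
noncomputable def pairCycles (F : Type) [Field F] [Fintype F] (d : ℕ) :
    Finset (RatPair F d × Finset (Option F)) :=
  Finset.univ.filter fun x => IsCycleSet (ratMap x.1.1.1 x.1.1.2) x.2

theorem card_pairCycles_le :
    (pairCycles F d).card ≤ Nat.card Fˣ * Nat.card {x : RatFn F d × Finset (Option F) //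
      ∃ p, Quot.mk _ p = x.1 ∧ IsCycleSet (ratMap p.1.1 p.1.2) x.2} := by
  rw [← Nat.card_prod, ← Fintype.card_coe, ← Nat.card_eq_fintype_card]
  obtain ⟨r, hr⟩ := (RatPair.toRatFn_surjective (F := F) (d := d)).hasRightInverse
  choose u hu using fun p : RatPair F d => RatPair.exists_unit_smul (hr p.toRatFn)
  refine Nat.card_le_card_of_injective (fun x : pairCycles F d => (u x.1.1,
    ⟨(x.1.1.toRatFn, x.1.2), x.1.1, rfl, (Finset.mem_filter.1 x.2).2⟩)) ?_
  rintro ⟨⟨p, c⟩, hx⟩ ⟨⟨p', c'⟩, hx'⟩ h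
  simp only [Prod.mk.injEq, Subtype.mk.injEq] at h
  obtain ⟨h1, h2, rfl⟩ := h
  have : p = p' := Subtype.ext (by rw [hu p, hu p', h1, h2])
  subst this
  rfl

theorem card_coprimePairs_le (S : Finset F) (v : F → F) :
    (coprimePairs d S v).card ≤ (Finset.univ.filter fun p : RatPair F d =>
      ∀ s ∈ S, p.1.1.eval s = v s * p.1.2.eval s).card := by
  rw [← Finset.card_map (Function.Embedding.subtype _)]
  refine Finset.card_le_card fun p hp => ?_
  obtain ⟨hp, hco, hdeg⟩ := Finset.mem_filter.1 hp
  obtain ⟨⟨-, hg⟩, hv⟩ := mem_pairsLT.1 hp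
  have hg' : p.2.natDegree ≤ d := natDegree_le_iff_degree_le.2 (Order.le_of_lt_succ hg)
  refine Finset.mem_map.2 ⟨⟨p, hco, by rw [hdeg, max_eq_left hg']⟩, ?_, rfl⟩
  exact Finset.mem_filter.2 ⟨Finset.mem_univ _, hv⟩

end Scaling

section Cycles

variable {F : Type} {d k : ℕ}

/-- The points of `P¹(F)` visited by `α`. -/
def pointSet [NeZero k] (α : ZMod k ↪ F) : Finset (Option F) :=
  Finset.univ.map (α.trans Function.Embedding.some)

theorem mem_pointSet [NeZero k] {α : ZMod k ↪ F} {x : Option F} :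
    x ∈ pointSet α ↔ ∃ i, some (α i) = x := by
  simp [pointSet]

theorem card_pointSet [NeZero k] (α : ZMod k ↪ F) : (pointSet α).card = k := by
  rw [pointSet, Finset.card_map, Finset.card_univ, ZMod.card]

variable [Field F]

/-- The map induced by `p` sends `α i` to `α (i + 1)` for every `i`. -/
def Follows (p : RatPair F d) (α : ZMod k ↪ F) : Prop :=
  ∀ i, p.1.1.eval (α i) = α (i + 1) * p.1.2.eval (α i)

theorem Follows.ratMap_eq {p : RatPair F d} {α : ZMod k ↪ F} (h : Follows p α) (i : ZMod k) :
    ratMap p.1.1 p.1.2 (some (α i)) = some (α (i + 1)) := by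
  have hg : p.1.2.eval (α i) ≠ 0 := by
    intro h0
    have hf : p.1.1.eval (α i) = 0 := by rw [h i, h0, mul_zero]
    obtain ⟨a, b, hab⟩ := p.2.1
    simpa [hf, h0] using congrArg (eval (α i)) hab
  simp [ratMap, hg, h i]

theorem Follows.iterate_ratMap_eq {p : RatPair F d} {α : ZMod k ↪ F} (h : Follows p α)
    (i : ZMod k) (j : ℕ) :
    (ratMap p.1.1 p.1.2)^[j] (some (α i)) = some (α (i + j)) := by
  induction j with
  | zero => simp
  | succ j ih =>
    rw [Function.iterate_succ_apply', ih, h.ratMap_eq, Nat.cast_succ, add_assoc]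

variable [NeZero k]

theorem Follows.isCycleSet {p : RatPair F d} {α : ZMod k ↪ F} (h : Follows p α) :
    IsCycleSet (ratMap p.1.1 p.1.2) (pointSet α) := by
  refine ⟨⟨some (α 0), mem_pointSet.2 ⟨0, rfl⟩⟩, fun x hx => ?_, fun x hx y hy => ?_⟩
  · obtain ⟨i, rfl⟩ := mem_pointSet.1 hx
    exact mem_pointSet.2 ⟨i + 1, (h.ratMap_eq i).symm⟩
  · obtain ⟨i, rfl⟩ := mem_pointSet.1 hx
    obtain ⟨l, rfl⟩ := mem_pointSet.1 hy
    refine ⟨(l - i).val, ?_⟩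
    rw [h.iterate_ratMap_eq, ZMod.natCast_zmod_val, add_sub_cancel]

theorem Follows.embedding_ext {p : RatPair F d} {α β : ZMod k ↪ F} (hα : Follows p α)
    (hβ : Follows p β) (h0 : α 0 = β 0) : α = β := by
  ext i
  have h1 := hα.iterate_ratMap_eq 0 i.val
  have h2 := hβ.iterate_ratMap_eq 0 i.val
  rw [zero_add, ZMod.natCast_zmod_val] at h1 h2
  rw [h0, h2] at h1
  exact (Option.some_injective _ h1).symm

variable [Fintype F]

theorem le_card_follows (hk : k ≤ d) (α : ZMod k ↪ F) :
    Fintype.card F ^ (2 * d + 2 - k) ≤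
      (Finset.univ.filter fun p : RatPair F d => Follows p α).card +
        (2 * k + 3) * Fintype.card F ^ (2 * d + 1 - k) := by
  have hS : (Finset.univ.map α).card = k := by rw [Finset.card_map, Finset.card_univ, ZMod.card]
  have h1 := le_card_coprimePairs (d := d) (S := Finset.univ.map α) (hS.trans_le hk)
    (Function.extend α (fun i => α (i + 1)) 0)
  have h2 := card_coprimePairs_le (d := d) (Finset.univ.map α)
    (Function.extend α (fun i => α (i + 1)) 0)
  simp only [Finset.mem_map, Finset.mem_univ, true_and, forall_exists_index,
    forall_apply_eq_imp_iff, α.injective.extend_apply] at h2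
  rw [hS] at h1
  refine h1.trans (Nat.add_le_add_right (h2.trans (Finset.card_le_card fun p hp => ?_)) _)
  exact Finset.mem_filter.2 ⟨Finset.mem_univ _, (Finset.mem_filter.1 hp).2⟩

theorem sum_card_follows_le :
    ∑ α : ZMod k ↪ F, (Finset.univ.filter fun p : RatPair F d => Follows p α).card ≤
      k * ((pairCycles F d).filter fun x => x.2.card = k).card := by
  rw [← Finset.card_sigma]
  refine Finset.card_le_mul_card_image_of_maps_to
    (f := fun x : (_ : ZMod k ↪ F) × RatPair F d => (x.2, pointSet x.1)) ?_ _ ?_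
  · rintro ⟨α, p⟩ hx
    have hp : Follows p α := by simpa using hx
    exact Finset.mem_filter.2
      ⟨Finset.mem_filter.2 ⟨Finset.mem_univ _, hp.isCycleSet⟩, card_pointSet α⟩
  · rintro ⟨p, c⟩ hpc
    have hc : c.card = k := (Finset.mem_filter.1 hpc).2
    conv_rhs => rw [← hc]
    refine Finset.card_le_card_of_injOn (fun x => some (x.1 0)) ?_ ?_
    · rintro ⟨α, p'⟩ hx
      simp only [Finset.coe_filter, Set.mem_ofPred_eq, Prod.mk.injEq] at hx
      obtain ⟨-, -, rfl⟩ := hx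
      exact mem_pointSet.2 ⟨0, rfl⟩
    · rintro ⟨α, p'⟩ hx ⟨β, p''⟩ hy h
      simp only [Finset.coe_filter, Finset.mem_sigma, Finset.mem_univ, true_and,
        Finset.mem_filter, Set.mem_ofPred_eq, Prod.mk.injEq] at hx hy
      obtain ⟨hα, rfl, -⟩ := hx
      obtain ⟨hβ, rfl, -⟩ := hy
      rw [hα.embedding_ext hβ (Option.some_injective _ h)]

theorem descFactorial_mul_pow_le (hk : k ≤ d) :
    (Fintype.card F).descFactorial k * Fintype.card F ^ (2 * d + 2 - k) ≤
      k * ((pairCycles F d).filter fun x => x.2.card = k).card +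
        (Fintype.card F).descFactorial k *
          ((2 * k + 3) * Fintype.card F ^ (2 * d + 1 - k)) := by
  have hcard : Fintype.card (ZMod k ↪ F) = (Fintype.card F).descFactorial k := by
    rw [Fintype.card_embedding_eq, ZMod.card]
  have h := Finset.sum_le_sum fun (α : ZMod k ↪ F) (_ : α ∈ Finset.univ) =>
    le_card_follows (d := d) hk α
  rw [Finset.sum_add_distrib, Finset.sum_const, Finset.sum_const, Finset.card_univ, hcard,
    smul_eq_mul, smul_eq_mul] at h
  exact h.trans (Nat.add_le_add_right sum_card_follows_le _)

end Cycles

section Estimates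

theorem one_sub_le_descFactorial_div {q k : ℕ} (hk : 0 < k) (hkq : k ≤ q) :
    1 - (k : ℝ) ^ 2 / q ≤ (q.descFactorial k : ℝ) / (q : ℝ) ^ k := by
  have hq : (0 : ℝ) < q := by exact_mod_cast hk.trans_le hkq
  have hkq' : (k : ℝ) ≤ q := by exact_mod_cast hkq
  have hk' : (1 : ℝ) ≤ k := by exact_mod_cast hk
  have hle : ((k : ℝ) - 1) / q ≤ 1 := by rw [div_le_one hq]; linarith
  have h1 : ((q : ℝ) + 1 - k) ^ k ≤ q.descFactorial k := by
    have := Nat.pow_sub_le_descFactorial q k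
    have h2 : (((q + 1 - k : ℕ) : ℝ)) ^ k ≤ q.descFactorial k := by exact_mod_cast this
    rwa [Nat.cast_sub (by omega), Nat.cast_add, Nat.cast_one] at h2
  have h2 := one_add_mul_le_pow (a := -(((k : ℝ) - 1) / q)) (by linarith) k
  have h3 : (1 + -(((k : ℝ) - 1) / q)) ^ k = ((q : ℝ) + 1 - k) ^ k / (q : ℝ) ^ k := by
    rw [← div_pow]
    congr 1
    field_simp
    ring
  have h4 : (k : ℝ) * -(((k : ℝ) - 1) / q) = -((k : ℝ) ^ 2 / q) + k / q := by ring
  have h5 : (0 : ℝ) ≤ k / q := by positivity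
  calc 1 - (k : ℝ) ^ 2 / q ≤ (1 + -(((k : ℝ) - 1) / q)) ^ k := by linarith
    _ = ((q : ℝ) + 1 - k) ^ k / (q : ℝ) ^ k := h3
    _ ≤ _ := by gcongr

theorem le_card_cycles_of_card {F : Type} [Field F] [Fintype F] {d k : ℕ} (hk : 0 < k)
    (hkd : k ≤ d) (hkq : k ≤ Fintype.card F) :
    (1 - ((k : ℝ) ^ 2 + 2 * k + 3) / Fintype.card F) / k * (Fintype.card F : ℝ) ^ (2 * d + 2) ≤
      ((pairCycles F d).filter fun x => x.2.card = k).card := by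
  have : NeZero k := ⟨hk.ne'⟩
  have h := descFactorial_mul_pow_le (F := F) hkd
  set C := ((pairCycles F d).filter fun x => x.2.card = k).card
  set q := Fintype.card F
  have hq0 : 0 < q := hk.trans_le hkq
  have hq : (0 : ℝ) < q := by exact_mod_cast hq0
  have hk' : (0 : ℝ) < k := by exact_mod_cast hk
  have h' : (q.descFactorial k : ℝ) * (q : ℝ) ^ (2 * d + 2 - k) ≤
      k * C + q.descFactorial k * ((2 * k + 3) * (q : ℝ) ^ (2 * d + 1 - k)) := by
    exact_mod_cast h
  have hx := one_sub_le_descFactorial_div hk hkq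
  have hx1 : (q.descFactorial k : ℝ) / (q : ℝ) ^ k ≤ 1 := by
    rw [div_le_one (by positivity)]
    exact_mod_cast Nat.descFactorial_le_pow q k
  set x := (q.descFactorial k : ℝ) / (q : ℝ) ^ k with hxdef
  have hD : (q.descFactorial k : ℝ) = x * (q : ℝ) ^ k := by
    rw [hxdef]; field_simp
  have hp1 : (q : ℝ) ^ k * (q : ℝ) ^ (2 * d + 2 - k) = (q : ℝ) ^ (2 * d + 2) := by
    rw [← pow_add]; congr 1; omega
  have hp2 : (q : ℝ) ^ k * (q : ℝ) ^ (2 * d + 1 - k) = (q : ℝ) ^ (2 * d + 2) / q := by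
    rw [← pow_add, eq_div_iff hq.ne', ← pow_succ]; congr 1; omega
  set N := (q : ℝ) ^ (2 * d + 2)
  have hN : 0 ≤ N := by positivity
  have h2 : x * N ≤ k * C + x * ((2 * k + 3) * (N / q)) := by
    rw [hD, mul_assoc, hp1] at h'
    calc x * N ≤ _ := h'
      _ = k * C + x * ((2 * k + 3) * ((q : ℝ) ^ k * (q : ℝ) ^ (2 * d + 1 - k))) := by ring
      _ = _ := by rw [hp2]
  have hb : 0 ≤ (2 * (k : ℝ) + 3) / q := by positivity
  have h3 : 1 - ((k : ℝ) ^ 2 + 2 * k + 3) / q ≤ x * (1 - (2 * k + 3) / q) := by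
    have h4 : ((k : ℝ) ^ 2 + 2 * k + 3) / q = (k : ℝ) ^ 2 / q + (2 * k + 3) / q := by ring
    have h5 := mul_le_mul_of_nonneg_right hx1 hb
    rw [h4]
    linarith
  rw [div_mul_eq_mul_div, div_le_iff₀ hk']
  calc (1 - ((k : ℝ) ^ 2 + 2 * k + 3) / q) * N ≤ x * (1 - (2 * k + 3) / q) * N := by gcongr
    _ = x * N - x * ((2 * k + 3) * (N / q)) := by ring
    _ ≤ C * k := by linarith

theorem sum_card_filter_card_le {ι S : Type*} (s : Finset (ι × Finset S)) (t : Finset ℕ) :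
    ∑ k ∈ t, (s.filter fun x => x.2.card = k).card ≤ s.card := by
  rw [Finset.sum_card_fiberwise_eq_card_filter]
  exact Finset.card_filter_le _ _

theorem sum_inv_sub_lt_of_two_le {q m : ℕ} (hm : 2 ≤ m) (hmq : m * m ≤ q) :
    (∑ k ∈ Finset.Icc 1 m, (1 : ℝ) / k) - 4 <
      ∑ k ∈ Finset.Icc 1 m, (1 - ((k : ℝ) ^ 2 + 2 * k + 3) / q) / k := by
  have hm' : (2 : ℝ) ≤ m := by exact_mod_cast hm
  have hmq' : (m : ℝ) * m ≤ q := by exact_mod_cast hmq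
  have hq : (0 : ℝ) < q := by nlinarith
  rw [sub_lt_comm, ← Finset.sum_sub_distrib]
  have hterm : ∀ k ∈ Finset.Icc 1 m,
      (1 : ℝ) / k - (1 - ((k : ℝ) ^ 2 + 2 * k + 3) / q) / k ≤ (m + 5) / q := by
    intro k hk
    obtain ⟨h1, h2⟩ := Finset.mem_Icc.1 hk
    have h1' : (1 : ℝ) ≤ k := by exact_mod_cast h1
    have h2' : (k : ℝ) ≤ m := by exact_mod_cast h2
    have : (1 : ℝ) / k - (1 - ((k : ℝ) ^ 2 + 2 * k + 3) / q) / k =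
        (((k : ℝ) ^ 2 + 2 * k + 3) / k) / q := by ring
    rw [this]
    gcongr
    rw [div_le_iff₀ (by linarith)]
    nlinarith
  refine (Finset.sum_le_card_nsmul _ _ _ hterm).trans_lt ?_
  rw [Nat.card_Icc, Nat.add_sub_cancel, nsmul_eq_mul, mul_div_assoc', div_lt_iff₀ hq]
  nlinarith

theorem log_add_one_lt_sum_inv {m : ℕ} (hm : 0 < m) :
    Real.log (m + 1) < ∑ k ∈ Finset.Icc 1 m, (1 : ℝ) / k := by
  induction m, hm using Nat.le_induction with
  | base =>
    have h := Real.log_lt_sub_one_of_pos (x := 2) two_pos (by norm_num)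
    norm_num at h ⊢
    exact h
  | succ m hm ih =>
    rw [Finset.sum_Icc_succ_top (by omega)]
    have h0 : (0 : ℝ) < (m : ℝ) + 1 := by positivity
    have h1 : (((m + 1 : ℕ) : ℝ) + 1) = (m + 1) * (1 + 1 / (m + 1)) := by
      push_cast; field_simp
    have h2 : (0 : ℝ) < 1 / ((m : ℝ) + 1) := by positivity
    rw [h1, Real.log_mul (by positivity) (by positivity)]
    have h3 := Real.log_le_sub_one_of_pos (x := 1 + 1 / ((m : ℝ) + 1)) (by positivity)
    push_cast
    linarith

end Estimates

/-- **Theorem 3.6.** The average number `R(q,d)` of cycles (equivalently, connected components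
of the functional graph) of a rational function on `P¹(F_q)` of degree exactly `d` satisfies
`R(q,d) > Σ_{k=1}^{min{d,⌊√q⌋}} 1/k - 4 > ln(min{d,⌊√q⌋} + 1) - 4`. -/
theorem avg_cycles_of_rational_functions_lower_bound
    (q d : ℕ) (F : Type) [Field F] [Fintype F] (hF : Fintype.card F = q)
    (hd : 0 < d)
    (R : ℝ)
    (hR : R = (Nat.card {x : RatFn F d × Finset (Option F) //
          ∃ p, Quot.mk _ p = x.1 ∧ IsCycleSet (ratMap p.1.1 p.1.2) x.2} : ℝ) /
        (Nat.card (RatFn F d) : ℝ)) :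
    R > (∑ k ∈ Finset.Icc 1 (min d (Nat.sqrt q)), (1 : ℝ) / k) - 4 ∧
    (∑ k ∈ Finset.Icc 1 (min d (Nat.sqrt q)), (1 : ℝ) / k) - 4
      > Real.log (min d (Nat.sqrt q) + 1) - 4 := by
  subst hF
  set q := Fintype.card F
  set m := min d (Nat.sqrt q)
  have hq1 : 1 < q := Fintype.one_lt_card
  have hmpos : 0 < m := lt_min hd (Nat.sqrt_pos.2 (by omega))
  refine ⟨?_, ?_⟩
  swap
  · have := log_add_one_lt_sum_inv hmpos
    linarith
  have hR0 : 0 ≤ R := by rw [hR]; positivity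
  rcases Nat.lt_or_ge m 2 with hm2 | hm2
  · have : m = 1 := by omega
    rw [this]
    norm_num
    linarith
  refine (sum_inv_sub_lt_of_two_le hm2 ((Nat.mul_le_mul (min_le_right _ _)
    (min_le_right _ _)).trans (Nat.sqrt_le q))).trans_le ?_
  have hA := card_units_mul_card_ratFn_le (F := F) (d := d)
  have hB := card_pairCycles_le (F := F) (d := d)
  have hC := card_ratPair_le (F := F) (d := d)
  have hne : Nonempty (RatFn F d) :=
    ⟨RatPair.toRatFn ⟨(X ^ d, 1), isCoprime_one_right, by simp⟩⟩
  have hQ : 0 < Nat.card (RatFn F d) := Nat.card_pos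
  have hU : 0 < Nat.card Fˣ := Nat.card_pos
  rw [hR, ← mul_div_mul_left _ _ (Nat.cast_ne_zero.2 hU.ne' : (Nat.card Fˣ : ℝ) ≠ 0),
    le_div_iff₀ (by positivity)]
  have hsum : (∑ k ∈ Finset.Icc 1 m, (1 - ((k : ℝ) ^ 2 + 2 * k + 3) / q) / k) *
      (q : ℝ) ^ (2 * d + 2) ≤ (pairCycles F d).card := by
    rw [Finset.sum_mul]
    have hle := sum_card_filter_card_le (pairCycles F d) (Finset.Icc 1 m)
    rw [← Nat.cast_le (α := ℝ), Nat.cast_sum] at hle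
    refine (Finset.sum_le_sum fun k hk => ?_).trans hle
    obtain ⟨h1, h2⟩ := Finset.mem_Icc.1 hk
    exact le_card_cycles_of_card h1 (h2.trans (min_le_left _ _))
      (h2.trans ((min_le_right _ _).trans (Nat.sqrt_le_self q)))
  set T := ∑ k ∈ Finset.Icc 1 m, (1 - ((k : ℝ) ^ 2 + 2 * k + 3) / q) / k
  have hAC : (Nat.card Fˣ : ℝ) * Nat.card (RatFn F d) ≤ (q : ℝ) ^ (2 * d + 2) := by
    exact_mod_cast hA.trans hC
  rcases le_or_gt T 0 with hT | hT
  · exact (mul_nonpos_of_nonpos_of_nonneg hT (by positivity)).trans (by positivity)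
  · exact ((mul_le_mul_of_nonneg_left hAC hT.le).trans hsum).trans (by exact_mod_cast hB)
end
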